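/- arXiv:2504.11694 — 9 statements merged into one kernel-verified Lean document; each statement's English description precedes it below -/
import Mathlib

section
/- Let C and D be categories such that every morphism f of C is assigned a cost cost_C(f) ∈ [0,∞) and every morphism g of D is assigned a cost cost_D(g) ∈ [0,∞). Let F : C → D be a functor and M ∈ (0,∞) be such that cost_D(F(f)) ≤ M · cost_C(f) for every morphism f of C. Then for any two objects A and B of C, d^E_D(F(A), F(B)) ≤ M · d^E_C(A, B). -/
/-!
STATEMENT 0: Functorial edit distance stability.
Given categories `C`, `D` with nonnegative costs on morphisms, a functor `F : C ⥤ D`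
and `M > 0` with `cost_D (F f) ≤ M * cost_C f` for all morphisms `f` of `C`, then
`d^E_D (F A, F B) ≤ M * d^E_C (A, B)` for all objects `A B` of `C`.

A path between objects `A` and `B` is a finite zigzag of morphisms (each pointing in
either direction); its cost is the sum of the costs of its morphisms, and the edit
distance is the infimum of the costs of paths (`∞` if there is no path).
-/

open CategoryTheory
open scoped ENNReal

universe v u v' u'

/-- A zigzag path of morphisms between two objects of a category. -/
inductive EditZigzag {C : Type u} [Category.{v} C] : C → C → Type (max u v)
  | nil (A : C) : EditZigzag A A
  | fwd {A B E : C} (f : A ⟶ B) (p : EditZigzag B E) : EditZigzag A E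
  | bwd {A B E : C} (f : B ⟶ A) (p : EditZigzag B E) : EditZigzag A E

/-- The cost of a zigzag path: the sum of the costs of its morphisms. -/
noncomputable def zigzagCost {C : Type u} [Category.{v} C]
    (cost : ∀ {A B : C}, (A ⟶ B) → ℝ) : ∀ {A B : C}, EditZigzag A B → ℝ
  | _, _, .nil _ => 0
  | _, _, .fwd f p => cost f + zigzagCost cost p
  | _, _, .bwd f p => cost f + zigzagCost cost p

/-- The edit distance between two objects: the infimum of the costs of zigzag paths
between them. -/
noncomputable def editDist {C : Type u} [Category.{v} C]
    (cost : ∀ {A B : C}, (A ⟶ B) → ℝ) (A B : C) : ℝ≥0∞ :=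
  ⨅ p : EditZigzag A B, ENNReal.ofReal (zigzagCost cost p)

/-- The image of a zigzag path under a functor. -/
def EditZigzag.map {C : Type u} {D : Type u'} [Category.{v} C] [Category.{v'} D] (F : C ⥤ D) :
    ∀ {A B : C}, EditZigzag A B → EditZigzag (F.obj A) (F.obj B)
  | _, _, .nil A => .nil (F.obj A)
  | _, _, .fwd f p => .fwd (F.map f) (p.map F)
  | _, _, .bwd f p => .bwd (F.map f) (p.map F)

theorem zigzagCost_map_le {C : Type u} {D : Type u'} [Category.{v} C] [Category.{v'} D]
    (costC : ∀ {A B : C}, (A ⟶ B) → ℝ) (costD : ∀ {A B : D}, (A ⟶ B) → ℝ)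
    (F : C ⥤ D) (M : ℝ)
    (hFM : ∀ {A B : C} (f : A ⟶ B), costD (F.map f) ≤ M * costC f)
    {A B : C} (p : EditZigzag A B) :
    zigzagCost costD (p.map F) ≤ M * zigzagCost costC p := by
  induction p with
  | nil A => simp [EditZigzag.map, zigzagCost]
  | fwd f p ih =>
    simp only [EditZigzag.map, zigzagCost, mul_add]
    exact add_le_add (hFM f) ih
  | bwd f p ih =>
    simp only [EditZigzag.map, zigzagCost, mul_add]
    exact add_le_add (hFM f) ih

theorem functorial_edit_distance_stability
    {C : Type u} {D : Type u'} [Category.{v} C] [Category.{v'} D]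
    (costC : ∀ {A B : C}, (A ⟶ B) → ℝ) (costD : ∀ {A B : D}, (A ⟶ B) → ℝ)
    (hC : ∀ {A B : C} (f : A ⟶ B), 0 ≤ costC f)
    (hD : ∀ {A B : D} (f : A ⟶ B), 0 ≤ costD f)
    (F : C ⥤ D) (M : ℝ) (hM : 0 < M)
    (hFM : ∀ {A B : C} (f : A ⟶ B), costD (F.map f) ≤ M * costC f)
    (A B : C) :
    editDist costD (F.obj A) (F.obj B) ≤ ENNReal.ofReal M * editDist costC A B := by
  unfold editDist
  rw [ENNReal.mul_iInf_of_ne (ENNReal.ofReal_pos.mpr hM).ne' ENNReal.ofReal_ne_top]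
  refine le_iInf fun p => (iInf_le _ (p.map F)).trans ?_
  rw [← ENNReal.ofReal_mul hM.le]
  exact ENNReal.ofReal_le_ofReal (zigzagCost_map_le costC costD F M hFM p)
end

section
/- For any two finite pseudo-metric spaces (X,d_X) and (Y,d_Y), the edit distance in the category Met equals twice the Gromov–Hausdorff distance: d^E_Met(X,Y) = 2 · d_GH(X,Y). -/
/-!
STATEMENT 1: For any two finite pseudo-metric spaces `(X, d_X)` and `(Y, d_Y)`, the
edit distance in the category `Met` equals twice the Gromov–Hausdorff distance:
`d^E_Met(X, Y) = 2 · d_GH(X, Y)`.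

Objects of `Met` are finite (nonempty) pseudo-metric spaces; morphisms are surjective
metric order-preserving maps, with cost the distortion.  A path is a finite zigzag of
morphisms (pointing in either direction), its cost is the sum of the costs, and the
edit distance is the infimum of the costs of paths.  The Gromov–Hausdorff distance is
half the infimum of the distortions of tripods.
-/

open scoped ENNReal

noncomputable section

/-- A finite pseudo-metric space. -/
structure FPMet where
  carrier : Type
  [fin : Fintype carrier]
  [ne : Nonempty carrier]
  d : carrier → carrier → ℝ
  nonneg : ∀ x y, 0 ≤ d x y
  symm : ∀ x y, d x y = d y x
  refl : ∀ x, d x x = 0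
  triangle : ∀ x y z, d x z ≤ d x y + d y z

attribute [instance] FPMet.fin FPMet.ne

/-- A metric morphism: a surjective metric order-preserving map. -/
structure MetHom (X Y : FPMet) where
  toFun : X.carrier → Y.carrier
  surj : Function.Surjective toFun
  ordPres : ∀ a b c e : X.carrier,
    X.d c e ≤ X.d a b → Y.d (toFun c) (toFun e) ≤ Y.d (toFun a) (toFun b)

/-- The cost of a metric morphism: its distortion. -/
def MetHom.cost {X Y : FPMet} (f : MetHom X Y) : ℝ :=
  ⨆ a : X.carrier, ⨆ b : X.carrier, |X.d a b - Y.d (f.toFun a) (f.toFun b)|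

/-- A zigzag path of metric morphisms. -/
inductive MetPath : FPMet → FPMet → Type 1
  | nil (X : FPMet) : MetPath X X
  | fwd {X Y Z : FPMet} (f : MetHom X Y) (p : MetPath Y Z) : MetPath X Z
  | bwd {X Y Z : FPMet} (f : MetHom Y X) (p : MetPath Y Z) : MetPath X Z

/-- The cost of a path: the sum of the costs of its morphisms. -/
def metPathCost : ∀ {X Y : FPMet}, MetPath X Y → ℝ
  | _, _, .nil _ => 0
  | _, _, .fwd f p => f.cost + metPathCost p
  | _, _, .bwd f p => f.cost + metPathCost p

/-- The edit distance between finite pseudo-metric spaces. -/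
def editDistMet (X Y : FPMet) : ℝ≥0∞ :=
  ⨅ p : MetPath X Y, ENNReal.ofReal (metPathCost p)

/-- A tripod between two finite pseudo-metric spaces: a pair of surjections from a
finite nonempty set `Z`. -/
structure Tripod (X Y : FPMet) where
  Z : Type
  [finZ : Fintype Z]
  [neZ : Nonempty Z]
  φX : Z → X.carrier
  φY : Z → Y.carrier
  surjX : Function.Surjective φX
  surjY : Function.Surjective φY

attribute [instance] Tripod.finZ Tripod.neZ

/-- The distortion of a tripod. -/
def Tripod.dis {X Y : FPMet} (R : Tripod X Y) : ℝ :=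
  ⨆ z : R.Z, ⨆ z' : R.Z, |X.d (R.φX z) (R.φX z') - Y.d (R.φY z) (R.φY z')|

/-- The Gromov–Hausdorff distance between finite pseudo-metric spaces. -/
def dGH (X Y : FPMet) : ℝ≥0∞ :=
  (1 / 2) * ⨅ R : Tripod X Y, ENNReal.ofReal R.dis

open Filter Topology

theorem MetHom.abs_sub_le_cost {X Y : FPMet} (f : MetHom X Y) (a b : X.carrier) :
    |X.d a b - Y.d (f.toFun a) (f.toFun b)| ≤ f.cost :=
  (le_ciSup (f := fun b => |X.d a b - Y.d (f.toFun a) (f.toFun b)|)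
      (Set.finite_range _).bddAbove b).trans
    (le_ciSup (f := fun a => ⨆ b, |X.d a b - Y.d (f.toFun a) (f.toFun b)|)
      (Set.finite_range _).bddAbove a)

theorem MetHom.cost_le {X Y : FPMet} (f : MetHom X Y) {c : ℝ}
    (h : ∀ a b, |X.d a b - Y.d (f.toFun a) (f.toFun b)| ≤ c) : f.cost ≤ c :=
  ciSup_le fun a => ciSup_le fun b => h a b

theorem Tripod.abs_sub_le_dis {X Y : FPMet} (R : Tripod X Y) (z w : R.Z) :
    |X.d (R.φX z) (R.φX w) - Y.d (R.φY z) (R.φY w)| ≤ R.dis :=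
  (le_ciSup (f := fun w => |X.d (R.φX z) (R.φX w) - Y.d (R.φY z) (R.φY w)|)
      (Set.finite_range _).bddAbove w).trans
    (le_ciSup (f := fun z => ⨆ w, |X.d (R.φX z) (R.φX w) - Y.d (R.φY z) (R.φY w)|)
      (Set.finite_range _).bddAbove z)

theorem Tripod.dis_le {X Y : FPMet} (R : Tripod X Y) {c : ℝ}
    (h : ∀ z w, |X.d (R.φX z) (R.φX w) - Y.d (R.φY z) (R.φY w)| ≤ c) : R.dis ≤ c :=
  ciSup_le fun z => ciSup_le fun w => h z w

/-- The tripod whose legs are the identity. -/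
def Tripod.id (X : FPMet) : Tripod X X where
  Z := X.carrier
  φX := fun x => x
  φY := fun x => x
  surjX := Function.surjective_id
  surjY := Function.surjective_id

/-- Postcomposing the left leg of a tripod with a metric morphism. -/
def Tripod.mapLeft {X Y W : FPMet} (R : Tripod Y W) (f : MetHom Y X) : Tripod X W where
  Z := R.Z
  φX := f.toFun ∘ R.φX
  φY := R.φY
  surjX := f.surj.comp R.surjX
  surjY := R.surjY

/-- Pulling back a tripod along a metric morphism into its left foot. -/
def Tripod.pullLeft {X Y W : FPMet} (R : Tripod Y W) (f : MetHom X Y) : Tripod X W where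
  Z := {q : X.carrier × R.Z // f.toFun q.1 = R.φX q.2}
  finZ := Fintype.ofFinite _
  neZ :=
    let x := Classical.arbitrary X.carrier
    ⟨⟨(x, (R.surjX (f.toFun x)).choose), (R.surjX (f.toFun x)).choose_spec.symm⟩⟩
  φX := fun q => q.1.1
  φY := fun q => R.φY q.1.2
  surjX := fun x =>
    let ⟨z, hz⟩ := R.surjX (f.toFun x)
    ⟨⟨(x, z), hz.symm⟩, rfl⟩
  surjY := fun w =>
    let ⟨z, hz⟩ := R.surjY w
    let ⟨x, hx⟩ := f.surj (R.φX z)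
    ⟨⟨(x, z), hx⟩, hz⟩

theorem MetPath.exists_tripod_dis_le {X Y : FPMet} (p : MetPath X Y) :
    ∃ R : Tripod X Y, R.dis ≤ metPathCost p := by
  induction p with
  | nil X => exact ⟨Tripod.id X, Tripod.dis_le _ fun z w => by simp [Tripod.id, metPathCost]⟩
  | fwd f p ih =>
    obtain ⟨R, hR⟩ := ih
    refine ⟨R.pullLeft f, Tripod.dis_le _ fun z w => ?_⟩
    have h₁ := f.abs_sub_le_cost z.1.1 w.1.1
    have h₂ := R.abs_sub_le_dis z.1.2 w.1.2
    rw [z.2, w.2] at h₁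
    exact (abs_sub_le _ _ _).trans (add_le_add h₁ (h₂.trans hR))
  | bwd f p ih =>
    obtain ⟨R, hR⟩ := ih
    refine ⟨R.mapLeft f, Tripod.dis_le _ fun z w => ?_⟩
    have h₁ := f.abs_sub_le_cost (R.φX z) (R.φX w)
    have h₂ := R.abs_sub_le_dis z w
    rw [abs_sub_comm] at h₁
    exact (abs_sub_le _ _ _).trans (add_le_add h₁ (h₂.trans hR))

namespace Tripod

variable {X Y : FPMet} (R : Tripod X Y)

/-- The convex combination with weight `t` on `X` of the two distances pulled back to the apex. -/
def interpDist (t : ℝ) (z w : R.Z) : ℝ :=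
  t * X.d (R.φX z) (R.φX w) + (1 - t) * Y.d (R.φY z) (R.φY w)

/-- The apex of a tripod with the distance `R.interpDist t`. -/
def interp (t : ℝ) (ht : t ∈ Set.Icc (0 : ℝ) 1) : FPMet where
  carrier := R.Z
  d := R.interpDist t
  nonneg := fun z w => add_nonneg (mul_nonneg ht.1 (X.nonneg _ _))
    (mul_nonneg (sub_nonneg.2 ht.2) (Y.nonneg _ _))
  symm := fun z w => by simp only [interpDist, X.symm (R.φX z), Y.symm (R.φY z)]
  refl := fun z => by simp [interpDist, X.refl, Y.refl]
  triangle := fun u v w => by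
    have h₁ := mul_le_mul_of_nonneg_left (X.triangle (R.φX u) (R.φX v) (R.φX w)) ht.1
    have h₂ := mul_le_mul_of_nonneg_left (Y.triangle (R.φY u) (R.φY v) (R.φY w))
      (sub_nonneg.2 ht.2)
    simp only [interpDist]
    linarith

/-- The left leg as a metric morphism. -/
def homX (h : (1 : ℝ) ∈ Set.Icc (0 : ℝ) 1) : MetHom (R.interp 1 h) X where
  toFun := R.φX
  surj := R.surjX
  ordPres := fun a b c e => by simp [interp, interpDist]

/-- The right leg as a metric morphism. -/
def homY (h : (0 : ℝ) ∈ Set.Icc (0 : ℝ) 1) : MetHom (R.interp 0 h) Y where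
  toFun := R.φY
  surj := R.surjY
  ordPres := fun a b c e => by simp [interp, interpDist]

theorem abs_interpDist_sub_le (s t : ℝ) (z w : R.Z) :
    |R.interpDist s z w - R.interpDist t z w| ≤ |s - t| * R.dis := by
  have h : R.interpDist s z w - R.interpDist t z w =
      (s - t) * (X.d (R.φX z) (R.φX w) - Y.d (R.φY z) (R.φY w)) := by
    simp only [interpDist]; ring
  rw [h, abs_mul]
  exact mul_le_mul_of_nonneg_left (R.abs_sub_le_dis z w) (abs_nonneg _)

/-- Strict inequalities between interpolated distances persist near a given parameter, so the
identity of the apex is order-preserving from nearby parameters. -/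
theorem eventually_exists_hom (t : ℝ) (ht : t ∈ Set.Icc (0 : ℝ) 1) :
    ∀ᶠ s in 𝓝 t, ∀ hs : s ∈ Set.Icc (0 : ℝ) 1,
      ∃ f : MetHom (R.interp s hs) (R.interp t ht), f.cost ≤ |s - t| * R.dis := by
  have key : ∀ᶠ s in 𝓝 t, ∀ a b c e : R.Z,
      R.interpDist t a b < R.interpDist t c e → R.interpDist s a b < R.interpDist s c e := by
    simp only [eventually_all]
    intro a b c e h
    have hc : ∀ z w : R.Z, Continuous fun s => R.interpDist s z w := fun z w => by
      unfold interpDist; fun_prop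
    exact (hc a b).continuousAt.eventually_lt (hc c e).continuousAt h
  filter_upwards [key] with s h hs
  exact ⟨⟨fun z => z, Function.surjective_id,
      fun a b c e hle => not_lt.1 fun hlt => not_lt.2 hle (h a b c e hlt)⟩,
    MetHom.cost_le _ fun a b => R.abs_interpDist_sub_le s t a b⟩

theorem exists_path_interp_one (h1 : (1 : ℝ) ∈ Set.Icc (0 : ℝ) 1) :
    ∃ p : MetPath (R.interp 1 h1) Y, metPathCost p ≤ R.dis := by
  let S : Set ℝ := {t | ∃ (ht : t ∈ Set.Icc (0 : ℝ) 1),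
    ∃ p : MetPath (R.interp t ht) Y, metPathCost p ≤ t * R.dis}
  have h0 : (0 : ℝ) ∈ S := by
    refine ⟨by simp, .fwd (R.homY (by simp)) (.nil Y), ?_⟩
    have : (R.homY (by simp)).cost ≤ 0 :=
      MetHom.cost_le _ fun a b => by simp [homY, interp, interpDist]
    simpa [metPathCost] using this
  have hbdd : BddAbove S := ⟨1, fun s hs => hs.1.2⟩
  set u := sSup S
  have hu : u ∈ Set.Icc (0 : ℝ) 1 := ⟨le_csSup hbdd h0, csSup_le ⟨0, h0⟩ fun s hs => hs.1.2⟩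
  obtain ⟨ε, hε, hball⟩ := Metric.eventually_nhds_iff.1 (R.eventually_exists_hom u hu)
  have huS : u ∈ S := by
    obtain ⟨s, ⟨hs, p, hp⟩, hlt⟩ := exists_lt_of_lt_csSup ⟨0, h0⟩ (sub_lt_self u hε)
    have hsu : s ≤ u := le_csSup hbdd ⟨hs, p, hp⟩
    have habs : |s - u| = u - s := by rw [abs_sub_comm, abs_of_nonneg (by linarith)]
    obtain ⟨f, hf⟩ := hball (y := s) (by rw [Real.dist_eq, habs]; linarith) hs
    refine ⟨hu, .bwd f p, ?_⟩
    rw [habs] at hf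
    simp only [metPathCost]
    linarith
  have hu1 : u = 1 := by
    by_contra hne
    have hlt : u < 1 := lt_of_le_of_ne hu.2 hne
    let s := min 1 (u + ε / 2)
    have hus : u < s := lt_min hlt (by linarith)
    have hs : s ∈ Set.Icc (0 : ℝ) 1 := ⟨hu.1.trans hus.le, min_le_left _ _⟩
    have habs : |s - u| = s - u := abs_of_nonneg (by linarith)
    have hsε : s ≤ u + ε / 2 := min_le_right _ _
    obtain ⟨f, hf⟩ := hball (y := s) (by rw [Real.dist_eq, habs]; linarith) hs
    obtain ⟨_, p, hp⟩ := huS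
    refine absurd (le_csSup hbdd (a := s) ⟨hs, .fwd f p, ?_⟩) (not_le.2 hus)
    rw [habs] at hf
    simp only [metPathCost]
    linarith
  rw [hu1] at huS
  simpa using huS.2

theorem exists_path_cost_le : ∃ p : MetPath X Y, metPathCost p ≤ R.dis := by
  have h1 : (1 : ℝ) ∈ Set.Icc (0 : ℝ) 1 := by simp
  obtain ⟨p, hp⟩ := R.exists_path_interp_one h1
  have : (R.homX h1).cost ≤ 0 := MetHom.cost_le _ fun a b => by simp [homX, interp, interpDist]
  refine ⟨.bwd (R.homX h1) p, ?_⟩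
  simp only [metPathCost]
  linarith

end Tripod

theorem editDist_eq_two_mul_dGH (X Y : FPMet) :
    editDistMet X Y = 2 * dGH X Y := by
  rw [dGH, ← mul_assoc, one_div, ENNReal.mul_inv_cancel two_ne_zero ENNReal.ofNat_ne_top, one_mul]
  apply le_antisymm
  · refine le_iInf fun R => ?_
    obtain ⟨p, hp⟩ := R.exists_path_cost_le
    exact iInf_le_of_le p (ENNReal.ofReal_le_ofReal hp)
  · refine le_iInf fun p => ?_
    obtain ⟨R, hR⟩ := p.exists_tripod_dis_le
    exact iInf_le_of_le R (ENNReal.ofReal_le_ofReal hR)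
end
end

section
/- Let Z be a finite set, let d_1 and d_2 be pseudo-metrics on Z such that d_2 is a metric specialization of d_1, and let g : D(Z,d_2) → D(Z,d_1) be given by g(r) = max{ d_1(z,z') : z,z' ∈ Z, d_2(z,z') ≤ r }. Then for every r ∈ D(Z,d_2) and every z,z' ∈ Z, if d_1(z,z') = g(r) then d_2(z,z') = r. -/
/-!
STATEMENT 4: Let `Z` be finite, `d₁, d₂` pseudo-metrics on `Z` with `d₂` a metric
specialization of `d₁`, and let `g(r) = max { d₁(z,z') : d₂(z,z') ≤ r }`.  Then for
every `r ∈ D(Z,d₂)` and all `z, z' ∈ Z`, if `d₁(z,z') = g(r)` then `d₂(z,z') = r`.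
-/

theorem d2_eq_of_d1_eq_greatest
    {Z : Type} [Fintype Z] [Nonempty Z]
    (d₁ d₂ : Z → Z → ℝ)
    (h₁nonneg : ∀ x y, 0 ≤ d₁ x y) (h₁symm : ∀ x y, d₁ x y = d₁ y x)
    (h₁refl : ∀ x, d₁ x x = 0) (h₁tri : ∀ x y z, d₁ x z ≤ d₁ x y + d₁ y z)
    (h₂nonneg : ∀ x y, 0 ≤ d₂ x y) (h₂symm : ∀ x y, d₂ x y = d₂ y x)
    (h₂refl : ∀ x, d₂ x x = 0) (h₂tri : ∀ x y z, d₂ x z ≤ d₂ x y + d₂ y z)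
    (hspec : ∀ a b c e : Z, d₁ c e ≤ d₁ a b → d₂ c e ≤ d₂ a b)
    (r : ℝ) (hr : ∃ a b : Z, d₂ a b = r)
    (gr : ℝ)
    (hgr : IsGreatest {s : ℝ | ∃ z z' : Z, s = d₁ z z' ∧ d₂ z z' ≤ r} gr) :
    ∀ z z' : Z, d₁ z z' = gr → d₂ z z' = r := by
  intro z z' hz
  obtain ⟨a, b, rfl⟩ := hr
  obtain ⟨⟨w, w', hw, hle⟩, hub⟩ := hgr
  refine le_antisymm ((hspec w w' z z' (hz.trans hw).le).trans hle) ?_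
  exact hspec z z' a b ((hub ⟨a, b, rfl, le_rfl⟩).trans hz.ge)
end

section
/- Let Z be a finite set, let d_1 and d_2 be pseudo-metrics on Z such that d_2 is a metric specialization of d_1, and let g : D(Z,d_2) → D(Z,d_1) be given by g(r) = max{ d_1(z,z') : z,z' ∈ Z, d_2(z,z') ≤ r }. Then for every r ∈ D(Z,d_2), the Vietoris–Rips complexes coincide: VR((Z,d_2), r) = VR((Z,d_1), g(r)); equivalently, for every nonempty subset S ⊆ Z, one has (d_2(z,z') ≤ r for all z,z' ∈ S) if and only if (d_1(z,z') ≤ g(r) for all z,z' ∈ S). -/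
/-!
STATEMENT 5: Let `Z` be finite, `d₁, d₂` pseudo-metrics on `Z` with `d₂` a metric
specialization of `d₁`, and let `g(r) = max { d₁(z,z') : d₂(z,z') ≤ r }`.  Then for
every `r ∈ D(Z,d₂)`, the Vietoris–Rips complexes coincide:
`VR((Z,d₂), r) = VR((Z,d₁), g(r))`; equivalently, for every nonempty subset `S ⊆ Z`,
`(∀ z z' ∈ S, d₂(z,z') ≤ r) ↔ (∀ z z' ∈ S, d₁(z,z') ≤ g(r))`.
-/

theorem vietorisRips_eq_of_specialization
    {Z : Type} [Fintype Z] [Nonempty Z]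
    (d₁ d₂ : Z → Z → ℝ)
    (h₁nonneg : ∀ x y, 0 ≤ d₁ x y) (h₁symm : ∀ x y, d₁ x y = d₁ y x)
    (h₁refl : ∀ x, d₁ x x = 0) (h₁tri : ∀ x y z, d₁ x z ≤ d₁ x y + d₁ y z)
    (h₂nonneg : ∀ x y, 0 ≤ d₂ x y) (h₂symm : ∀ x y, d₂ x y = d₂ y x)
    (h₂refl : ∀ x, d₂ x x = 0) (h₂tri : ∀ x y z, d₂ x z ≤ d₂ x y + d₂ y z)
    (hspec : ∀ a b c e : Z, d₁ c e ≤ d₁ a b → d₂ c e ≤ d₂ a b)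
    (r : ℝ) (hr : ∃ a b : Z, d₂ a b = r)
    (gr : ℝ)
    (hgr : IsGreatest {s : ℝ | ∃ z z' : Z, s = d₁ z z' ∧ d₂ z z' ≤ r} gr) :
    ∀ S : Set Z, S.Nonempty →
      ((∀ z ∈ S, ∀ z' ∈ S, d₂ z z' ≤ r) ↔ (∀ z ∈ S, ∀ z' ∈ S, d₁ z z' ≤ gr)) := by
  obtain ⟨⟨a, b, rfl, hab⟩, hmax⟩ := hgr
  intro S _
  exact ⟨fun h z hz z' hz' => hmax ⟨z, z', rfl, h z hz z' hz'⟩,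
    fun h z hz z' hz' => (hspec a b z z' (h z hz z' hz')).trans hab⟩
end

section
/- Let Q, R ⊆ [0,∞) be finite subsets and let f : Q → R be an order-preserving (monotone) map. Then the distortion of f equals the maximal displacement over pairs of intervals: max_{q,q' ∈ Q} | |q − q'| − |f(q) − f(q')| | = max_{I_1, I_2 ∈ Q̄} defo(I_1, I_2, f̄(I_1), f̄(I_2)), where f̄([a,b]) := [f(a), f(b)]. -/
/-!
STATEMENT 7: Let `Q, R ⊆ [0,∞)` be finite subsets and `f : Q → R` order-preserving.
Then the distortion of `f` equals the maximal displacement over pairs of intervals: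
`max_{q,q' ∈ Q} | |q−q'| − |f q − f q'| | = max_{I₁,I₂ ∈ Q̄} defo(I₁, I₂, f̄ I₁, f̄ I₂)`,
where `f̄ [a,b] := [f a, f b]`.
-/

/-- The set of intervals `Q̄` of a finite subset `Q ⊆ ℝ`, as pairs `(a,b)` with
`a ≤ b`, both in `Q`. -/
noncomputable def Ibar (Q : Finset ℝ) : Finset (ℝ × ℝ) :=
  (Q ×ˢ Q).filter fun p => p.1 ≤ p.2

/-- The displacement `defo(I₁, I₂, J₁, J₂)` of two pairs of intervals, each interval
encoded as a pair (left endpoint, right endpoint). -/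
def defo (I₁ I₂ J₁ J₂ : ℝ × ℝ) : ℝ :=
  max (max |(I₁.1 - I₂.1) - (J₁.1 - J₂.1)| |(I₁.1 - I₂.2) - (J₁.1 - J₂.2)|)
      (max |(I₁.2 - I₂.1) - (J₁.2 - J₂.1)| |(I₁.2 - I₂.2) - (J₁.2 - J₂.2)|)

/-- A monotone map does not change the order of two points, so the inner absolute values in
the distortion of a pair of points may be dropped. -/
theorem MonotoneOn.abs_abs_sub_abs {s : Set ℝ} {f : ℝ → ℝ} (hf : MonotoneOn f s) {x y : ℝ}
    (hx : x ∈ s) (hy : y ∈ s) :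
    |(|x - y|) - (|f x - f y|)| = |(x - y) - (f x - f y)| := by
  rcases le_total x y with h | h
  · rw [abs_of_nonpos (sub_nonpos.2 h), abs_of_nonpos (sub_nonpos.2 (hf hx hy h)), ← abs_neg]
    congr 1
    ring
  · rw [abs_of_nonneg (sub_nonneg.2 h), abs_of_nonneg (sub_nonneg.2 (hf hy hx h))]

theorem mem_Ibar {Q : Finset ℝ} {p : ℝ × ℝ} : p ∈ Ibar Q ↔ (p.1 ∈ Q ∧ p.2 ∈ Q) ∧ p.1 ≤ p.2 := by
  simp [Ibar]

theorem distortion_eq_max_displacement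
    (Q R : Finset ℝ) (hQne : Q.Nonempty)
    (hQ : ∀ q ∈ Q, (0:ℝ) ≤ q) (hR : ∀ r ∈ R, (0:ℝ) ≤ r)
    (f : ℝ → ℝ) (hfR : ∀ q ∈ Q, f q ∈ R) (hf : MonotoneOn f Q) :
    sSup {v | ∃ q ∈ Q, ∃ q' ∈ Q, v = |(|q - q'|) - (|f q - f q'|)|} =
      sSup {v | ∃ I ∈ Ibar Q, ∃ J ∈ Ibar Q,
        v = defo I J (f I.1, f I.2) (f J.1, f J.2)} := by
  congr 1
  ext v
  constructor
  · rintro ⟨q, hq, q', hq', rfl⟩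
    refine ⟨(q, q), mem_Ibar.2 ⟨⟨hq, hq⟩, le_rfl⟩, (q', q'), mem_Ibar.2 ⟨⟨hq', hq'⟩, le_rfl⟩, ?_⟩
    simp only [defo, max_self]
    exact hf.abs_abs_sub_abs hq hq'
  · rintro ⟨⟨a, b⟩, hI, ⟨c, d⟩, hJ, rfl⟩
    obtain ⟨⟨ha, hb⟩, -⟩ := mem_Ibar.1 hI
    obtain ⟨⟨hc, hd⟩, -⟩ := mem_Ibar.1 hJ
    set S := {v | ∃ q ∈ Q, ∃ q' ∈ Q, v = |(|q - q'|) - (|f q - f q'|)|}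
    have mem_S {x y : ℝ} (hx : x ∈ Q) (hy : y ∈ Q) : |(x - y) - (f x - f y)| ∈ S :=
      ⟨x, hx, y, hy, (hf.abs_abs_sub_abs hx hy).symm⟩
    have max_mem_S {u v : ℝ} (hu : u ∈ S) (hv : v ∈ S) : max u v ∈ S := by
      rcases max_choice u v with h | h <;> rwa [h]
    exact max_mem_S (max_mem_S (mem_S ha hc) (mem_S ha hd))
      (max_mem_S (mem_S hb hc) (mem_S hb hd))
end

section
/- Let X and Y be finite sets with pseudo-metrics d_X and d_Y, let h : X → Y be any map, let μ : X → [0,1] be a probability weight (Σ_{x∈X} μ(x) = 1), and let p ∈ [1,∞). Then Σ_{x_1,x_2,x_3,x_4 ∈ X} | |d_X(x_1,x_2) − d_X(x_3,x_4)| − |d_Y(h x_1, h x_2) − d_Y(h x_3, h x_4)| |^p μ(x_1)μ(x_2)μ(x_3)μ(x_4) ≤ 2^p · Σ_{x,x' ∈ X} |d_X(x,x') − d_Y(h x, h x')|^p μ(x)μ(x'). -/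
/-!
STATEMENT 9: Let `X`, `Y` be finite sets with pseudo-metrics `d_X`, `d_Y`, let
`h : X → Y` be any map, `μ : X → [0,1]` a probability weight, and `p ∈ [1,∞)`.  Then
`Σ_{x₁,x₂,x₃,x₄} | |d_X(x₁,x₂) − d_X(x₃,x₄)| − |d_Y(h x₁,h x₂) − d_Y(h x₃,h x₄)| |^p`
`  · μ(x₁)μ(x₂)μ(x₃)μ(x₄) ≤ 2^p · Σ_{x,x'} |d_X(x,x') − d_Y(h x,h x')|^p μ(x)μ(x')`.
-/

/-- Pulling a quadrilateral inequality through the convexity of `t ↦ t ^ p`. -/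
theorem abs_abs_sub_sub_abs_sub_rpow_le (a b c d : ℝ) {p : ℝ} (hp : 1 ≤ p) :
    |(|a - b|) - (|c - d|)| ^ p ≤ 2 ^ (p - 1) * (|a - c| ^ p + |b - d| ^ p) := by
  have key : |(|a - b|) - (|c - d|)| ≤ |a - c| + |b - d| :=
    calc |(|a - b|) - (|c - d|)| ≤ |(a - b) - (c - d)| := abs_abs_sub_abs_le _ _
      _ = |(a - c) - (b - d)| := by congr 1; ring
      _ ≤ |a - c| + |b - d| := abs_sub _ _
  have convex := NNReal.rpow_add_le_mul_rpow_add_rpow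
    ⟨|a - c|, abs_nonneg _⟩ ⟨|b - d|, abs_nonneg _⟩ hp
  exact (Real.rpow_le_rpow (abs_nonneg _) key (by linarith)).trans (mod_cast convex)

/-- For a weight of total mass one, the sum over quadruples of `f x₁ x₂ + f x₃ x₄` is twice the sum
of `f` over pairs. -/
theorem sum_quadruple_add_mul {X : Type*} [Fintype X] (f : X → X → ℝ) (μ : X → ℝ)
    (hμ : ∑ x, μ x = 1) :
    ∑ x₁, ∑ x₂, ∑ x₃, ∑ x₄, (f x₁ x₂ + f x₃ x₄) * μ x₁ * μ x₂ * μ x₃ * μ x₄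
      = 2 * ∑ x, ∑ x', f x x' * μ x * μ x' := by
  have split : ∀ x₁ x₂ x₃ x₄, (f x₁ x₂ + f x₃ x₄) * μ x₁ * μ x₂ * μ x₃ * μ x₄
      = f x₁ x₂ * μ x₁ * μ x₂ * (μ x₃ * μ x₄) + μ x₁ * (μ x₂ * (f x₃ x₄ * μ x₃ * μ x₄)) := by
    intros; ring
  simp only [split, Finset.sum_add_distrib, ← Finset.mul_sum, ← Finset.sum_mul, hμ, mul_one,
    one_mul]
  ring

theorem quadruple_sum_le_two_rpow_mul
    {X Y : Type} [Fintype X] [Fintype Y] [Nonempty X] [Nonempty Y]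
    (dX : X → X → ℝ) (dY : Y → Y → ℝ)
    (hXnonneg : ∀ x y, 0 ≤ dX x y) (hXsymm : ∀ x y, dX x y = dX y x)
    (hXrefl : ∀ x, dX x x = 0) (hXtri : ∀ x y z, dX x z ≤ dX x y + dX y z)
    (hYnonneg : ∀ x y, 0 ≤ dY x y) (hYsymm : ∀ x y, dY x y = dY y x)
    (hYrefl : ∀ x, dY x x = 0) (hYtri : ∀ x y z, dY x z ≤ dY x y + dY y z)
    (h : X → Y)
    (μ : X → ℝ) (hμ0 : ∀ x, 0 ≤ μ x) (hμ1 : ∀ x, μ x ≤ 1) (hμsum : ∑ x, μ x = 1)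
    (p : ℝ) (hp : 1 ≤ p) :
    ∑ x₁, ∑ x₂, ∑ x₃, ∑ x₄,
        |(|dX x₁ x₂ - dX x₃ x₄|) - (|dY (h x₁) (h x₂) - dY (h x₃) (h x₄)|)| ^ p
          * μ x₁ * μ x₂ * μ x₃ * μ x₄
      ≤ 2 ^ p * ∑ x, ∑ x', |dX x x' - dY (h x) (h x')| ^ p * μ x * μ x' := by
  have le_quadruple : ∀ x₁ x₂ x₃ x₄,
      |(|dX x₁ x₂ - dX x₃ x₄|) - (|dY (h x₁) (h x₂) - dY (h x₃) (h x₄)|)| ^ p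
          * μ x₁ * μ x₂ * μ x₃ * μ x₄
        ≤ 2 ^ (p - 1) * ((|dX x₁ x₂ - dY (h x₁) (h x₂)| ^ p + |dX x₃ x₄ - dY (h x₃) (h x₄)| ^ p)
          * μ x₁ * μ x₂ * μ x₃ * μ x₄) := by
    intro x₁ x₂ x₃ x₄
    simp only [← mul_assoc]
    have := hμ0 x₁
    have := hμ0 x₂
    have := hμ0 x₃
    have := hμ0 x₄
    gcongr
    exact abs_abs_sub_sub_abs_sub_rpow_le _ _ _ _ hp
  refine (Finset.sum_le_sum fun x₁ _ => Finset.sum_le_sum fun x₂ _ => Finset.sum_le_sum fun x₃ _ =>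
    Finset.sum_le_sum fun x₄ _ => le_quadruple x₁ x₂ x₃ x₄).trans_eq ?_
  simp only [← Finset.mul_sum]
  rw [sum_quadruple_add_mul (fun x x' => |dX x x' - dY (h x) (h x')| ^ p) μ hμsum,
    ← mul_assoc, Real.rpow_sub_one two_ne_zero, div_mul_cancel₀ _ two_ne_zero]
end

section
/- Let Q, R ⊆ [0,∞) be finite subsets, let f : Q → R be an order-preserving (monotone) map, let μ : Q → [0,1] be a probability weight, and let p ∈ [1,∞). Then Σ_{q_1,q_2,q_3,q_4 ∈ Q} defo(flip(q_1,q_2), flip(q_3,q_4), flip(f q_1, f q_2), flip(f q_3, f q_4))^p μ(q_1)μ(q_2)μ(q_3)μ(q_4) ≤ 4 · Σ_{q,q' ∈ Q} | |q − q'| − |f(q) − f(q')| |^p μ(q)μ(q'). -/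
/-- `flip(q₁,q₂) = [min(q₁,q₂), max(q₁,q₂)]`. -/
def flipPair (a b : ℝ) : ℝ × ℝ := (min a b, max a b)

/-- For a monotone map, the discrepancy between the distances of two points and of their images
is the difference of the values of `x - f x`. -/
theorem abs_abs_sub_sub_abs_sub_eq {s : Set ℝ} {f : ℝ → ℝ} (hf : MonotoneOn f s) {a b : ℝ}
    (ha : a ∈ s) (hb : b ∈ s) :
    |(|a - b|) - (|f a - f b|)| = |(a - b) - (f a - f b)| := by
  rcases le_total a b with h | h
  · have hab := hf ha hb h
    rw [abs_of_nonpos (sub_nonpos.2 h), abs_of_nonpos (sub_nonpos.2 hab), ← abs_neg]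
    congr 1
    ring
  · have hba := hf hb ha h
    rw [abs_of_nonneg (sub_nonneg.2 h), abs_of_nonneg (sub_nonneg.2 hba)]

/-- Unordered pairs of points are flipped compatibly with a monotone map. -/
theorem flipPair_eq_or {s : Set ℝ} {f : ℝ → ℝ} (hf : MonotoneOn f s) {a b : ℝ}
    (ha : a ∈ s) (hb : b ∈ s) :
    (flipPair a b = (a, b) ∧ flipPair (f a) (f b) = (f a, f b)) ∨
      (flipPair a b = (b, a) ∧ flipPair (f a) (f b) = (f b, f a)) := by
  rcases le_total a b with h | h
  · have hab := hf ha hb h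
    left
    simp [flipPair, h, hab]
  · have hba := hf hb ha h
    right
    simp [flipPair, h, hba]

theorem max_max_rpow_le_add {x y z w p : ℝ} (hx : 0 ≤ x) (hy : 0 ≤ y) (hz : 0 ≤ z)
    (hw : 0 ≤ w) :
    max (max x y) (max z w) ^ p ≤ x ^ p + y ^ p + z ^ p + w ^ p := by
  have hx' := Real.rpow_nonneg hx p
  have hy' := Real.rpow_nonneg hy p
  have hz' := Real.rpow_nonneg hz p
  have hw' := Real.rpow_nonneg hw p
  rcases max_choice (max x y) (max z w) with h | h <;> rw [h]
  · rcases max_choice x y with h | h <;> rw [h] <;> linarith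
  · rcases max_choice z w with h | h <;> rw [h] <;> linarith

/-- The `p`-th power of the displacement of flipped pairs is at most the sum of the `p`-th powers
of the four cross discrepancies. -/
theorem defo_flipPair_rpow_le {s : Set ℝ} {f : ℝ → ℝ} (hf : MonotoneOn f s) {a b c d : ℝ}
    (ha : a ∈ s) (hb : b ∈ s) (hc : c ∈ s) (hd : d ∈ s) (p : ℝ) :
    defo (flipPair a b) (flipPair c d) (flipPair (f a) (f b)) (flipPair (f c) (f d)) ^ p ≤
      |(|a - c|) - (|f a - f c|)| ^ p + |(|a - d|) - (|f a - f d|)| ^ p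
        + |(|b - c|) - (|f b - f c|)| ^ p + |(|b - d|) - (|f b - f d|)| ^ p := by
  rw [abs_abs_sub_sub_abs_sub_eq hf ha hc, abs_abs_sub_sub_abs_sub_eq hf ha hd,
    abs_abs_sub_sub_abs_sub_eq hf hb hc, abs_abs_sub_sub_abs_sub_eq hf hb hd]
  rcases flipPair_eq_or hf ha hb with ⟨h₁, h₂⟩ | ⟨h₁, h₂⟩ <;>
    rcases flipPair_eq_or hf hc hd with ⟨h₃, h₄⟩ | ⟨h₃, h₄⟩ <;>
    rw [h₁, h₂, h₃, h₄] <;>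
    refine (max_max_rpow_le_add (abs_nonneg _) (abs_nonneg _) (abs_nonneg _)
      (abs_nonneg _)).trans (le_of_eq ?_) <;>
    ring

/-- Averaging the four cross terms of a kernel over independent quadruples gives four times its
average over pairs. -/
theorem sum_four_cross_terms_eq {α : Type*} (Q : Finset α) (μ : α → ℝ) (h : α → α → ℝ)
    (hμ : ∑ q ∈ Q, μ q = 1) :
    ∑ a ∈ Q, ∑ b ∈ Q, ∑ c ∈ Q, ∑ d ∈ Q,
        (h a c + h a d + h b c + h b d) * μ a * μ b * μ c * μ d
      = 4 * ∑ a ∈ Q, ∑ b ∈ Q, h a b * μ a * μ b := by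
  have hl : ∀ x : ℝ, ∑ q ∈ Q, x * μ q = x := fun x => by rw [← Finset.mul_sum, hμ, mul_one]
  have hac : ∑ a ∈ Q, ∑ b ∈ Q, ∑ c ∈ Q, ∑ d ∈ Q, h a c * μ a * μ b * μ c * μ d
      = ∑ a ∈ Q, ∑ b ∈ Q, h a b * μ a * μ b := by
    simp only [hl]
    refine Finset.sum_congr rfl fun a _ => ?_
    rw [Finset.sum_comm]
    refine Finset.sum_congr rfl fun c _ => ?_
    simp only [mul_right_comm _ (μ _) (μ c), hl]
  have had : ∑ a ∈ Q, ∑ b ∈ Q, ∑ c ∈ Q, ∑ d ∈ Q, h a d * μ a * μ b * μ c * μ d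
      = ∑ a ∈ Q, ∑ b ∈ Q, h a b * μ a * μ b := by
    rw [← hac]
    refine Finset.sum_congr rfl fun a _ => Finset.sum_congr rfl fun b _ => ?_
    rw [Finset.sum_comm]
    exact Finset.sum_congr rfl fun c _ => Finset.sum_congr rfl fun d _ => by ring
  have hbc : ∑ a ∈ Q, ∑ b ∈ Q, ∑ c ∈ Q, ∑ d ∈ Q, h b c * μ a * μ b * μ c * μ d
      = ∑ a ∈ Q, ∑ b ∈ Q, h a b * μ a * μ b := by
    rw [← hac, Finset.sum_comm]
    exact Finset.sum_congr rfl fun a _ => Finset.sum_congr rfl fun b _ =>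
      Finset.sum_congr rfl fun c _ => Finset.sum_congr rfl fun d _ => by ring
  have hbd : ∑ a ∈ Q, ∑ b ∈ Q, ∑ c ∈ Q, ∑ d ∈ Q, h b d * μ a * μ b * μ c * μ d
      = ∑ a ∈ Q, ∑ b ∈ Q, h a b * μ a * μ b := by
    rw [← had, Finset.sum_comm]
    exact Finset.sum_congr rfl fun a _ => Finset.sum_congr rfl fun b _ =>
      Finset.sum_congr rfl fun c _ => Finset.sum_congr rfl fun d _ => by ring
  simp only [add_mul, Finset.sum_add_distrib]
  rw [hac, had, hbc, hbd]
  ring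

theorem weighted_quadruple_sum_le_four_mul
    (Q R : Finset ℝ)
    (hQ : ∀ q ∈ Q, (0:ℝ) ≤ q) (hR : ∀ r ∈ R, (0:ℝ) ≤ r)
    (f : ℝ → ℝ) (hfR : ∀ q ∈ Q, f q ∈ R) (hf : MonotoneOn f Q)
    (μ : ℝ → ℝ) (hμ0 : ∀ q ∈ Q, 0 ≤ μ q) (hμ1 : ∀ q ∈ Q, μ q ≤ 1)
    (hμsum : ∑ q ∈ Q, μ q = 1)
    (p : ℝ) (hp : 1 ≤ p) :
    ∑ q₁ ∈ Q, ∑ q₂ ∈ Q, ∑ q₃ ∈ Q, ∑ q₄ ∈ Q,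
        defo (flipPair q₁ q₂) (flipPair q₃ q₄)
            (flipPair (f q₁) (f q₂)) (flipPair (f q₃) (f q₄)) ^ p
          * μ q₁ * μ q₂ * μ q₃ * μ q₄
      ≤ 4 * ∑ q ∈ Q, ∑ q' ∈ Q,
          |(|q - q'|) - (|f q - f q'|)| ^ p * μ q * μ q' := by
  rw [← sum_four_cross_terms_eq Q μ (fun q q' => |(|q - q'|) - (|f q - f q'|)| ^ p) hμsum]
  refine Finset.sum_le_sum fun a ha => Finset.sum_le_sum fun b hb =>
    Finset.sum_le_sum fun c hc => Finset.sum_le_sum fun d hd => ?_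
  have ha' := hμ0 a ha
  have hb' := hμ0 b hb
  have hc' := hμ0 c hc
  have hd' := hμ0 d hd
  gcongr
  exact defo_flipPair_rpow_le hf ha hb hc hd p
end

section
/- Let A, B ⊆ ℝ be finite subsets, let ν : A × B → [0,∞) be any function, and let ε ≥ 0 be such that | |r − t| − |s − u| | ≤ ε whenever ν(r,s) > 0 and ν(t,u) > 0. Then for all (r_1,s_1), (r_2,s_2), (r_3,s_3), (r_4,s_4) ∈ A × B with ν positive at each of them, | max(|r_1 − r_3|, |r_2 − r_4|) − max(|s_1 − s_3|, |s_2 − s_4|) | ≤ 2ε. -/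
/-!
STATEMENT 12: Let `A, B ⊆ ℝ` be finite, `ν : A × B → [0,∞)` any function, and
`ε ≥ 0` such that `| |r − t| − |s − u| | ≤ ε` whenever `ν(r,s) > 0` and `ν(t,u) > 0`.
Then for all `(r₁,s₁), (r₂,s₂), (r₃,s₃), (r₄,s₄) ∈ A × B` with `ν` positive at each,
`| max(|r₁−r₃|, |r₂−r₄|) − max(|s₁−s₃|, |s₂−s₄|) | ≤ 2ε`.
-/

theorem max_dis_le_two_eps
    (A B : Finset ℝ) (ν : ℝ → ℝ → ℝ)
    (hν : ∀ r ∈ A, ∀ s ∈ B, 0 ≤ ν r s)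
    (ε : ℝ) (hε : 0 ≤ ε)
    (h : ∀ r ∈ A, ∀ s ∈ B, ∀ t ∈ A, ∀ u ∈ B,
      0 < ν r s → 0 < ν t u → |(|r - t|) - (|s - u|)| ≤ ε)
    (r₁ s₁ r₂ s₂ r₃ s₃ r₄ s₄ : ℝ)
    (hr₁ : r₁ ∈ A) (hs₁ : s₁ ∈ B) (hr₂ : r₂ ∈ A) (hs₂ : s₂ ∈ B)
    (hr₃ : r₃ ∈ A) (hs₃ : s₃ ∈ B) (hr₄ : r₄ ∈ A) (hs₄ : s₄ ∈ B)
    (hν₁ : 0 < ν r₁ s₁) (hν₂ : 0 < ν r₂ s₂) (hν₃ : 0 < ν r₃ s₃) (hν₄ : 0 < ν r₄ s₄) :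
    |(max |r₁ - r₃| |r₂ - r₄|) - (max |s₁ - s₃| |s₂ - s₄|)| ≤ 2 * ε := by
  calc |(max |r₁ - r₃| |r₂ - r₄|) - (max |s₁ - s₃| |s₂ - s₄|)|
      ≤ max |(|r₁ - r₃|) - (|s₁ - s₃|)| |(|r₂ - r₄|) - (|s₂ - s₄|)| :=
        abs_max_sub_max_le_max _ _ _ _
    _ ≤ ε := max_le (h r₁ hr₁ s₁ hs₁ r₃ hr₃ s₃ hs₃ hν₁ hν₃)
        (h r₂ hr₂ s₂ hs₂ r₄ hr₄ s₄ hs₄ hν₂ hν₄)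
    _ ≤ 2 * ε := by linarith
end

section
/- Let (X,d_X,μ_X) and (Y,d_Y,μ_Y) be finite metric measure spaces. Then the ∞-Gromov–Wasserstein distance between their flipped global distributions of distances satisfies d_GW,∞((D̄_X, ‖·‖_∞, μ_{D̄_X}), (D̄_Y, ‖·‖_∞, μ_{D̄_Y})) ≤ 4 · d_GW,∞((X,d_X,μ_X), (Y,d_Y,μ_Y)). -/
/-!
STATEMENT 13: Let `(X,d_X,μ_X)` and `(Y,d_Y,μ_Y)` be finite metric measure spaces.
Then the ∞-Gromov–Wasserstein distance between their flipped global distributions of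
distances satisfies
`d_GW,∞((D̄_X, ‖·‖_∞, μ_{D̄_X}), (D̄_Y, ‖·‖_∞, μ_{D̄_Y})) ≤ 4 · d_GW,∞(X, Y)`.

Here `D_X = im(d_X)`, `D̄_X` is the set of intervals `[a,b]` with `a ≤ b` in `D_X`,
with the ℓ∞ metric `‖[a,b]−[c,d]‖_∞ = max(|a−c|, |b−d|)`, and
`μ_{D̄_X} = flip_#(μ_GDD(X) ⊗ μ_GDD(X))` where `μ_GDD(X) = (d_X)_#(μ_X ⊗ μ_X)` and
`flip(q₁,q₂) = [min(q₁,q₂), max(q₁,q₂)]`.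
-/

open scoped ENNReal

noncomputable section

/-- A coupling between two probability weights on finite sets. -/
def IsCoupling {A B : Type} [Fintype A] [Fintype B]
    (μA : A → ℝ) (μB : B → ℝ) (μ : A → B → ℝ) : Prop :=
  (∀ a b, 0 ≤ μ a b) ∧ (∀ a, ∑ b, μ a b = μA a) ∧ (∀ b, ∑ a, μ a b = μB b)

/-- The ∞-distortion of a coupling. -/
def disInf {A B : Type} (dA : A → A → ℝ) (dB : B → B → ℝ) (μ : A → B → ℝ) : ℝ :=
  sSup {v | ∃ a b a' b', 0 < μ a b ∧ 0 < μ a' b' ∧ v = |dA a a' - dB b b'|}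

/-- The ∞-Gromov–Wasserstein distance between two finite metric measure spaces,
given as raw data. -/
def GWinf {A B : Type} [Fintype A] [Fintype B]
    (dA : A → A → ℝ) (μA : A → ℝ) (dB : B → B → ℝ) (μB : B → ℝ) : ℝ≥0∞ :=
  (1 / 2) * ⨅ μ : {μ : A → B → ℝ // IsCoupling μA μB μ},
    ENNReal.ofReal (disInf dA dB μ.1)

/-- `D_X`: the (finite) image of the metric `d`. -/
def distFinset {X : Type} [Fintype X] (d : X → X → ℝ) : Finset ℝ :=
  Finset.image (fun p : X × X => d p.1 p.2) Finset.univ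

/-- The intervals of `D_X`: pairs `(a,b)` with `a ≤ b`, both in `D_X`. -/
def intervalFinset {X : Type} [Fintype X] (d : X → X → ℝ) : Finset (ℝ × ℝ) :=
  (distFinset d ×ˢ distFinset d).filter fun p => p.1 ≤ p.2

/-- The carrier `D̄_X` of the flipped global distribution of distances. -/
def IntervalType {X : Type} [Fintype X] (d : X → X → ℝ) : Type :=
  {p : ℝ × ℝ // p ∈ intervalFinset d}

instance {X : Type} [Fintype X] (d : X → X → ℝ) : Fintype (IntervalType d) :=
  FinsetCoe.fintype _

/-- The ℓ∞ metric on intervals. -/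
def dInt {X : Type} [Fintype X] (d : X → X → ℝ) :
    IntervalType d → IntervalType d → ℝ :=
  fun I J => max |I.1.1 - J.1.1| |I.1.2 - J.1.2|

/-- The flipped global distribution of distances
`μ_{D̄_X} = flip_#((d_X)_#(μ_X ⊗ μ_X) ⊗ (d_X)_#(μ_X ⊗ μ_X))`. -/
def muFlip {X : Type} [Fintype X] (d : X → X → ℝ) (μ : X → ℝ) :
    IntervalType d → ℝ :=
  fun I => ∑ x₁, ∑ x₂, ∑ x₃, ∑ x₄,
    if (min (d x₁ x₂) (d x₃ x₄), max (d x₁ x₂) (d x₃ x₄)) = I.1 then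
      μ x₁ * μ x₂ * μ x₃ * μ x₄
    else 0

open scoped Classical in
/-- The pushforward of a weight on a finite type. -/
def pushWeight {P A : Type} [Fintype P] (f : P → A) (w : P → ℝ) : A → ℝ :=
  fun a => ∑ p, if f p = a then w p else 0

open scoped Classical in
/-- The pushforward of a coupling along a pair of maps. -/
def pushCoupling {P Q A B : Type} [Fintype P] [Fintype Q] (f : P → A) (g : Q → B)
    (π : P → Q → ℝ) : A → B → ℝ :=
  fun a b => ∑ p, ∑ q, if f p = a then (if g q = b then π p q else 0) else 0

theorem IsCoupling.prod {A B C D : Type} [Fintype A] [Fintype B] [Fintype C] [Fintype D]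
    {μA : A → ℝ} {μB : B → ℝ} {μC : C → ℝ} {μD : D → ℝ} {μ : A → B → ℝ} {ν : C → D → ℝ}
    (hμ : IsCoupling μA μB μ) (hν : IsCoupling μC μD ν) :
    IsCoupling (fun p : A × C => μA p.1 * μC p.2) (fun q : B × D => μB q.1 * μD q.2)
      (fun p q => μ p.1 q.1 * ν p.2 q.2) := by
  refine ⟨fun p q => mul_nonneg (hμ.1 _ _) (hν.1 _ _), fun p => ?_, fun q => ?_⟩
  · simp only [← hμ.2.1, ← hν.2.1, Fintype.sum_mul_sum, Fintype.sum_prod_type]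
  · simp only [← hμ.2.2, ← hν.2.2, Fintype.sum_mul_sum, Fintype.sum_prod_type]

theorem IsCoupling.push {P Q A B : Type} [Fintype P] [Fintype Q] [Fintype A] [Fintype B]
    {w : P → ℝ} {v : Q → ℝ} {π : P → Q → ℝ} (h : IsCoupling w v π) (f : P → A) (g : Q → B) :
    IsCoupling (pushWeight f w) (pushWeight g v) (pushCoupling f g π) := by
  classical
  refine ⟨fun a b => ?_, fun a => ?_, fun b => ?_⟩
  · refine Finset.sum_nonneg fun p _ => Finset.sum_nonneg fun q _ => ?_
    split_ifs
    exacts [h.1 p q, le_rfl, le_rfl]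
  · simp only [pushCoupling, pushWeight]
    rw [Finset.sum_comm]
    refine Finset.sum_congr rfl fun p _ => ?_
    rw [Finset.sum_comm]
    by_cases hp : f p = a <;> simp [hp, h.2.1]
  · simp only [pushCoupling, pushWeight]
    rw [Finset.sum_comm, Finset.sum_congr rfl fun p _ => Finset.sum_comm, Finset.sum_comm]
    refine Finset.sum_congr rfl fun q _ => ?_
    by_cases hq : g q = b <;> simp [hq, h.2.2]

theorem exists_pos_of_pushCoupling_pos {P Q A B : Type} [Fintype P] [Fintype Q]
    {f : P → A} {g : Q → B} {π : P → Q → ℝ} {a : A} {b : B} (h : 0 < pushCoupling f g π a b) :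
    ∃ p q, f p = a ∧ g q = b ∧ 0 < π p q := by
  obtain ⟨p, -, hp⟩ := Finset.exists_lt_of_sum_lt
    ((Finset.sum_const_zero (s := (Finset.univ : Finset P))).trans_lt h)
  obtain ⟨q, -, hq⟩ := Finset.exists_lt_of_sum_lt
    ((Finset.sum_const_zero (s := (Finset.univ : Finset Q))).trans_lt hp)
  split_ifs at hq with h₁ h₂
  exacts [⟨p, q, h₁, h₂, hq⟩, (lt_irrefl _ hq).elim, (lt_irrefl _ hq).elim]

theorem disInf_nonneg {A B : Type} (dA : A → A → ℝ) (dB : B → B → ℝ) (μ : A → B → ℝ) :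
    0 ≤ disInf dA dB μ := by
  refine Real.sSup_nonneg ?_
  rintro v ⟨a, b, a', b', -, -, rfl⟩
  exact abs_nonneg _

theorem abs_sub_le_disInf {A B : Type} [Finite A] [Finite B] (dA : A → A → ℝ) (dB : B → B → ℝ)
    {μ : A → B → ℝ} {a a' : A} {b b' : B} (h : 0 < μ a b) (h' : 0 < μ a' b') :
    |dA a a' - dB b b'| ≤ disInf dA dB μ := by
  refine le_csSup (Set.Finite.bddAbove ?_) ⟨a, b, a', b', h, h', rfl⟩
  refine (Set.finite_range fun t : A × B × A × B =>
    |dA t.1 t.2.2.1 - dB t.2.1 t.2.2.2|).subset ?_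
  rintro v ⟨a, b, a', b', -, -, rfl⟩
  exact ⟨(a, b, a', b'), rfl⟩

/-- The interval spanned by the distances of two pairs of points. -/
def flipDist {X : Type} [Fintype X] (d : X → X → ℝ) (t : (X × X) × (X × X)) : IntervalType d :=
  ⟨(min (d t.1.1 t.1.2) (d t.2.1 t.2.2), max (d t.1.1 t.1.2) (d t.2.1 t.2.2)), by
    have h (x y : X) : d x y ∈ distFinset d :=
      Finset.mem_image.2 ⟨(x, y), Finset.mem_univ _, rfl⟩
    refine Finset.mem_filter.2 ⟨Finset.mem_product.2 ⟨?_, ?_⟩, min_le_max⟩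
    · exact min_rec' (· ∈ distFinset d) (h _ _) (h _ _)
    · exact max_rec' (· ∈ distFinset d) (h _ _) (h _ _)⟩

theorem muFlip_eq_pushWeight {X : Type} [Fintype X] (d : X → X → ℝ) (μ : X → ℝ) :
    muFlip d μ = pushWeight (flipDist d)
      (fun t : (X × X) × (X × X) => (μ t.1.1 * μ t.1.2) * (μ t.2.1 * μ t.2.2)) := by
  funext I
  simp only [muFlip, pushWeight, Fintype.sum_prod_type, ← mul_assoc]
  refine Finset.sum_congr rfl fun x₁ _ => Finset.sum_congr rfl fun x₂ _ =>
    Finset.sum_congr rfl fun x₃ _ => Finset.sum_congr rfl fun x₄ _ => ?_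
  by_cases h : flipDist d ((x₁, x₂), (x₃, x₄)) = I
  · exact (if_pos (congrArg Subtype.val h)).trans (if_pos h).symm
  · exact (if_neg fun h' => h (Subtype.ext h')).trans (if_neg h).symm

theorem abs_max_abs_sub_le {a b c d a' b' c' d' δ : ℝ} (ha : |a - a'| ≤ δ) (hb : |b - b'| ≤ δ)
    (hc : |c - c'| ≤ δ) (hd : |d - d'| ≤ δ) :
    |(max |a - c| |b - d| - max |a' - c'| |b' - d'|)| ≤ 2 * δ := by
  have key {s t s' t' : ℝ} (hs : |s - s'| ≤ δ) (ht : |t - t'| ≤ δ) :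
      |(|s - t| - |s' - t'|)| ≤ 2 * δ := by
    refine (abs_abs_sub_abs_le _ _).trans ?_
    rw [abs_le] at *
    constructor <;> linarith
  exact (abs_max_sub_max_le_max _ _ _ _).trans (max_le (key ha hc) (key hb hd))

theorem disInf_pushCoupling_flipDist_le {X Y : Type} [Fintype X] [Fintype Y]
    (dX : X → X → ℝ) (dY : Y → Y → ℝ) {μ : X → Y → ℝ} (hμ : ∀ x y, 0 ≤ μ x y) :
    disInf (dInt dX) (dInt dY) (pushCoupling (flipDist dX) (flipDist dY)
      fun s t => (μ s.1.1 t.1.1 * μ s.1.2 t.1.2) * (μ s.2.1 t.2.1 * μ s.2.2 t.2.2)) ≤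
      2 * disInf dX dY μ := by
  have pos_of_mul {x y : ℝ} (hx : 0 ≤ x) (hy : 0 ≤ y) (h : 0 < x * y) : 0 < x ∧ 0 < y :=
    ⟨pos_of_mul_pos_left h hy, pos_of_mul_pos_right h hx⟩
  have close {s : (X × X) × (X × X)} {t : (Y × Y) × (Y × Y)}
      (h : 0 < (μ s.1.1 t.1.1 * μ s.1.2 t.1.2) * (μ s.2.1 t.2.1 * μ s.2.2 t.2.2)) :
      |(flipDist dX s).1.1 - (flipDist dY t).1.1| ≤ disInf dX dY μ ∧
        |(flipDist dX s).1.2 - (flipDist dY t).1.2| ≤ disInf dX dY μ := by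
    obtain ⟨h₁, h₂⟩ := pos_of_mul (mul_nonneg (hμ _ _) (hμ _ _)) (mul_nonneg (hμ _ _) (hμ _ _)) h
    obtain ⟨h₁₁, h₁₂⟩ := pos_of_mul (hμ _ _) (hμ _ _) h₁
    obtain ⟨h₂₁, h₂₂⟩ := pos_of_mul (hμ _ _) (hμ _ _) h₂
    have hmax := max_le (abs_sub_le_disInf dX dY h₁₁ h₁₂) (abs_sub_le_disInf dX dY h₂₁ h₂₂)
    exact ⟨(abs_min_sub_min_le_max _ _ _ _).trans hmax, (abs_max_sub_max_le_max _ _ _ _).trans hmax⟩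
  refine Real.sSup_le ?_ (mul_nonneg zero_le_two (disInf_nonneg _ _ _))
  rintro v ⟨I, J, I', J', h, h', rfl⟩
  obtain ⟨s, t, rfl, rfl, hst⟩ := exists_pos_of_pushCoupling_pos h
  obtain ⟨s', t', rfl, rfl, hst'⟩ := exists_pos_of_pushCoupling_pos h'
  exact abs_max_abs_sub_le (close hst).1 (close hst).2 (close hst').1 (close hst').2

theorem gwInf_flipped_gdd_stability
    {X Y : Type} [Fintype X] [Fintype Y] [Nonempty X] [Nonempty Y]
    (dX : X → X → ℝ) (dY : Y → Y → ℝ)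
    (hXnonneg : ∀ x y, 0 ≤ dX x y) (hXsymm : ∀ x y, dX x y = dX y x)
    (hXrefl : ∀ x, dX x x = 0) (hXsep : ∀ x y, dX x y = 0 → x = y)
    (hXtri : ∀ x y z, dX x z ≤ dX x y + dX y z)
    (hYnonneg : ∀ x y, 0 ≤ dY x y) (hYsymm : ∀ x y, dY x y = dY y x)
    (hYrefl : ∀ x, dY x x = 0) (hYsep : ∀ x y, dY x y = 0 → x = y)
    (hYtri : ∀ x y z, dY x z ≤ dY x y + dY y z)
    (μX : X → ℝ) (hμX : ∀ x, 0 < μX x) (hμXsum : ∑ x, μX x = 1)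
    (μY : Y → ℝ) (hμY : ∀ y, 0 < μY y) (hμYsum : ∑ y, μY y = 1) :
    GWinf (dInt dX) (muFlip dX μX) (dInt dY) (muFlip dY μY) ≤
      4 * GWinf dX μX dY μY := by
  rw [muFlip_eq_pushWeight, muFlip_eq_pushWeight]
  unfold GWinf
  rw [mul_left_comm, ENNReal.mul_iInf_of_ne (a := 4) (by norm_num) (by norm_num)]
  gcongr
  refine le_iInf fun μ => ?_
  have hμ := μ.2.prod μ.2
  refine (iInf_le _ ⟨_, (hμ.prod hμ).push (flipDist dX) (flipDist dY)⟩).trans ?_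
  rw [← ENNReal.ofReal_ofNat 4, ← ENNReal.ofReal_mul (by norm_num)]
  refine ENNReal.ofReal_le_ofReal ((disInf_pushCoupling_flipDist_le dX dY μ.2.1).trans ?_)
  linarith [disInf_nonneg dX dY μ.1]
end
end
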